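/- Let c, d ≥ 0 with (c,d) ≠ (0,0), and consider the cubic polynomial (z² + 2z + 2)(cz + d) = cz³ + (d+2c)z² + 2(c+d)z + 2d. The sequence of its coefficients (2d, 2(c+d), d+2c, c, 0), viewed as a sequence of length 5 (order n = 4), is ultra-logconcave with all entries of index 0 through 3 positive if and only if c = d. -/

import Mathlib

noncomputable def cin (n i : ℕ) : ℝ :=
  ((i : ℝ)/((i : ℝ)+1)) * (((n : ℝ)-(i : ℝ))/((n : ℝ)-(i : ℝ)+1))

def UltraLogConcave (n : ℕ) (a : ℕ → ℝ) : Prop :=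
  ∀ i, 1 ≤ i → i ≤ n - 1 → cin n i * (a i)^2 ≥ a (i-1) * a (i+1)

theorem cubic_factor_ULC_iff (c d : ℝ) (hc : 0 ≤ c) (hd : 0 ≤ d)
    (hcd : ¬(c = 0 ∧ d = 0)) :
    (UltraLogConcave 4 (fun i => [2*d, 2*(c+d), d+2*c, c, 0].getD i 0) ∧
        ∀ i ≤ 3, 0 < [2*d, 2*(c+d), d+2*c, c, 0].getD i 0) ↔ c = d := by
  constructor
  · rintro ⟨hulc, hpos⟩
    have hd0 : 0 < d := by simpa using hpos 0 (by norm_num)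
    have hc0 : 0 < c := by simpa using hpos 3 (by norm_num)
    have h1 := hulc 1 (by norm_num) (by norm_num)
    have h2 := hulc 2 (by norm_num) (by norm_num)
    norm_num [cin] at h1 h2
    have hdc : 0 ≤ (3 * c + d) * (c - d) := by linarith
    have hcd' : 0 ≤ (2 * d + c) * (d - c) := by linarith
    have hle := nonneg_of_mul_nonneg_right hdc (by positivity)
    have hge := nonneg_of_mul_nonneg_right hcd' (by positivity)
    linarith
  · rintro rfl
    have hc0 : 0 < c := hc.lt_of_ne fun h => hcd ⟨h.symm, h.symm⟩
    refine ⟨fun i hi hi' => ?_, fun i hi => ?_⟩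
    · have hi3 : i ≤ 3 := hi'
      interval_cases i <;> norm_num [cin] <;> nlinarith [sq_nonneg c]
    · interval_cases i <;> simp <;> linarith
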